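/- Higher-order Gladkov inequality: let G = (V,E,J) be a weighted graph, β ≥ 0, and for each finite vertex set A let τ(A) denote the probability that all vertices of A belong to the same cluster of Bernoulli bond percolation on G at parameter β. Then for every finite A with |A| ≥ 3, τ(A)² ≤ 4(|A|−1)²(2^{|A|−2}−1)·max τ(A₁∪A₂)τ(A₂∪A₃)τ(A₃∪A₁), where the maximum is over partitions of A into three nonempty subsets A₁, A₂, A₃. -/

import Mathlib

open MeasureTheory ENNReal Filter
open scoped Classical

namespace LRP

/-! ## Generic Bernoulli bond percolation -/

/-- The probability that an edge with rate `t ≥ 0` is open: `1 - e^{-t}`. -/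
noncomputable def edgeProb (t : ℝ) : ℝ := 1 - Real.exp (-t)

/-- `μ` is the law of Bernoulli bond percolation in which every unordered pair `e`
of vertices is open independently with probability `p e`: every finite cylinder
event has the corresponding product probability.  (This characterises `μ` uniquely.) -/
def IsPerc {Vt : Type*} (μ : Measure (Sym2 Vt → Bool)) (p : Sym2 Vt → ℝ) : Prop :=
  IsProbabilityMeasure μ ∧
    ∀ (s : Finset (Sym2 Vt)) (f : Sym2 Vt → Bool),
      μ {ω | ∀ e ∈ s, ω e = f e} =
        ∏ e ∈ s, ENNReal.ofReal (if f e then p e else 1 - p e)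

/-- Two vertices are connected if they are joined by a path of open edges. -/
def Conn {Vt : Type*} (ω : Sym2 Vt → Bool) (x y : Vt) : Prop :=
  Relation.ReflTransGen (fun a b => ω s(a, b) = true) x y

/-- The open cluster of a vertex. -/
def cluster {Vt : Type*} (ω : Sym2 Vt → Bool) (x : Vt) : Set Vt := {y | Conn ω x y}

/-- The number of points of a set, as an extended nonnegative real. -/
noncomputable def eCard {Vt : Type*} (s : Set Vt) : ℝ≥0∞ :=
  if s.Finite then (s.ncard : ℝ≥0∞) else ∞

/-! ## Long-range percolation on `ℤ^d` -/

abbrev V (d : ℕ) := Fin d → ℤ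

abbrev Config (d : ℕ) := Sym2 (V d) → Bool

noncomputable def toR {d : ℕ} (x : V d) : Fin d → ℝ := fun i => (x i : ℝ)

/-- The Euclidean norm of a lattice point. -/
noncomputable def enorm2 {d : ℕ} (x : V d) : ℝ := Real.sqrt (∑ i, ((x i : ℝ)) ^ 2)

/-- The `p`-th moment of the volume of the cluster of the origin. -/
noncomputable def clMom {d : ℕ} (μ : Measure (Config d)) (p : ℕ) : ℝ≥0∞ :=
  ∫⁻ ω, (eCard (cluster ω (0 : V d))) ^ p ∂μ

/-- `E Σ_{x ∈ K} ‖x‖₂^p`. -/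
noncomputable def gyr {d : ℕ} (μ : Measure (Config d)) (p : ℝ) : ℝ≥0∞ :=
  ∫⁻ ω, ∑' x : cluster ω (0 : V d), ENNReal.ofReal (enorm2 (x : V d) ^ p) ∂μ

/-- The `L^p` radius of gyration. -/
noncomputable def xi {d : ℕ} (μ : Measure (Config d)) (p : ℝ) : ℝ≥0∞ :=
  (gyr μ p / clMom μ 1) ^ (1 / p)

/-- A decreasing function `(0, ∞) → (0, 1]` decaying faster than any power. -/
def RapidDecay (h : ℝ → ℝ) : Prop :=
  AntitoneOn h (Set.Ioi (0 : ℝ)) ∧ (∀ t : ℝ, 0 < t → 0 < h t ∧ h t ≤ 1) ∧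
    ∀ p : ℝ, 0 < p → Tendsto (fun t => h t * t ^ p) atTop (nhds 0)

/-- The data of a long-range percolation kernel `J(x,y) = 𝟙(x ≠ y) J(‖x - y‖)` on `ℤ^d`,
together with the standing regularity and normalisation assumptions: `‖⋅‖` is a norm
whose unit ball has unit Lebesgue measure, `J` is decreasing and differentiable with
`|J'(r)| = (1 + δ_r) r^{-d-α-1}`, `δ_r → 0`, and `∫_{r₀}^∞ |δ_r| dr/r < ∞`. -/
structure Kernel (d : ℕ) (α : ℝ) where
  N : Seminorm ℝ (Fin d → ℝ)
  N_pos : ∀ x : Fin d → ℝ, x ≠ 0 → 0 < N x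
  N_ball : volume {x : Fin d → ℝ | N x ≤ 1} = 1
  J : ℝ → ℝ
  J' : ℝ → ℝ
  δ : ℝ → ℝ
  J_nonneg : ∀ r : ℝ, 0 < r → 0 ≤ J r
  J_anti : AntitoneOn J (Set.Ioi (0 : ℝ))
  J_hasDeriv : ∀ r : ℝ, 0 < r → HasDerivAt J (J' r) r
  J'_eq : ∀ r : ℝ, 0 < r → |J' r| = (1 + δ r) * r ^ (-(d : ℝ) - α - 1)
  δ_lim : Tendsto δ atTop (nhds 0)
  δ_int : ∃ r₀ : ℝ, 0 < r₀ ∧ IntegrableOn (fun r => |δ r| / r) (Set.Ioi r₀)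

namespace Kernel

variable {d : ℕ} {α : ℝ} (κ : Kernel d α)

/-- The distance between two lattice points in the norm `N`. -/
noncomputable def nd (x y : V d) : ℝ := κ.N (toR x - toR y)

theorem nd_symm (x y : V d) : κ.nd x y = κ.nd y x := by
  show κ.N (toR x - toR y) = κ.N (toR y - toR x)
  rw [show toR y - toR x = -(toR x - toR y) by abel, map_neg_eq_map]

/-- The kernel `J(x, y)`. -/
noncomputable def ker (x y : V d) : ℝ := if x = y then 0 else κ.J (κ.nd x y)

theorem ker_symm (x y : V d) : κ.ker x y = κ.ker y x := by
  show (if x = y then 0 else κ.J (κ.nd x y)) = (if y = x then 0 else κ.J (κ.nd y x))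
  rw [κ.nd_symm x y]
  exact if_congr eq_comm rfl rfl

/-- The cut-off kernel `J_r(x, y)`. -/
noncomputable def kerCut (r : ℝ) (x y : V d) : ℝ :=
  if x ≠ y ∧ κ.nd x y ≤ r then ∫ s in Set.Ioc (κ.nd x y) r, |κ.J' s| else 0

theorem kerCut_symm (r : ℝ) (x y : V d) : κ.kerCut r x y = κ.kerCut r y x := by
  show (if x ≠ y ∧ κ.nd x y ≤ r then ∫ s in Set.Ioc (κ.nd x y) r, |κ.J' s| else 0) =
    (if y ≠ x ∧ κ.nd y x ≤ r then ∫ s in Set.Ioc (κ.nd y x) r, |κ.J' s| else 0)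
  rw [κ.nd_symm x y]
  exact if_congr (and_congr_left' ne_comm) rfl rfl

/-- Edge probabilities at inverse temperature `β` for the kernel `J`. -/
noncomputable def edgeP (β : ℝ) : Sym2 (V d) → ℝ :=
  Sym2.lift ⟨fun x y => edgeProb (β * κ.ker x y), fun x y => by
    show edgeProb (β * κ.ker x y) = edgeProb (β * κ.ker y x)
    rw [κ.ker_symm x y]⟩

/-- Edge probabilities at inverse temperature `β` for the cut-off kernel `J_r`. -/
noncomputable def edgePCut (β r : ℝ) : Sym2 (V d) → ℝ :=
  Sym2.lift ⟨fun x y => edgeProb (β * κ.kerCut r x y), fun x y => by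
    show edgeProb (β * κ.kerCut r x y) = edgeProb (β * κ.kerCut r y x)
    rw [κ.kerCut_symm r x y]⟩

/-- The ball of radius `r` about the origin of `ℤ^d`, in the norm `N`. -/
def ball (r : ℝ) : Set (V d) := {x : V d | κ.N (toR x) ≤ r}

/-- There is an infinite cluster with positive probability at `β`. -/
def percolates (β : ℝ) : Prop :=
  ∀ μ : Measure (Config d), IsPerc μ (κ.edgeP β) →
    0 < μ {ω | ∃ x : V d, (cluster ω x).Infinite}

/-- The critical point `β_c`. -/
noncomputable def betaC : ℝ := sInf {β : ℝ | 0 ≤ β ∧ κ.percolates β}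

/-- The correlation length condition for effectively long-range critical behaviour:
`β_c < ∞` and for every `p > 0` the `L^p` radius of gyration of the cut-off model
at `β_c` satisfies `ξ_p(β_c, r) ≤ C_p r`. -/
def CL : Prop :=
  (∃ β : ℝ, 0 ≤ β ∧ κ.percolates β) ∧
    ∀ p : ℝ, 0 < p → ∃ C : ℝ, 0 < C ∧
      ∀ r : ℝ, 1 ≤ r → ∀ μ : Measure (Config d), IsPerc μ (κ.edgePCut κ.betaC r) →
        xi μ p ≤ ENNReal.ofReal (C * r)

/-- The weak correlation length condition: `β_c < ∞` and for each `ε > 0` there is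
`C` with `E_{β_c,r}|K|^p ≤ (1+ε) E_{β_c,r}|K ∩ B_{Cr}|^p` for all `r ≥ 1`, `p = 1,2,3,4`. -/
def wCL : Prop :=
  (∃ β : ℝ, 0 ≤ β ∧ κ.percolates β) ∧
    ∀ ε : ℝ, 0 < ε → ∃ C : ℝ, 0 < C ∧
      ∀ r : ℝ, 1 ≤ r → ∀ p : ℕ, p ∈ ({1, 2, 3, 4} : Finset ℕ) →
        ∀ μ : Measure (Config d), IsPerc μ (κ.edgePCut κ.betaC r) →
          (∫⁻ ω, (eCard (cluster ω (0 : V d))) ^ p ∂μ) ≤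
            ENNReal.ofReal (1 + ε) *
              ∫⁻ ω, (eCard (cluster ω (0 : V d) ∩ κ.ball (C * r))) ^ p ∂μ

/-- The `p`-th moment `E_β |K|^p` (for the full kernel). -/
noncomputable def mom (β : ℝ) (p : ℕ) : ℝ≥0∞ :=
  ⨆ μ ∈ {μ : Measure (Config d) | IsPerc μ (κ.edgeP β)}, clMom μ p

/-- The susceptibility `χ(β) = E_β |K|`. -/
noncomputable def chi (β : ℝ) : ℝ≥0∞ := κ.mom β 1

/-- `ζ(β) = E_β|K|² / E_β|K|`. -/
noncomputable def zeta (β : ℝ) : ℝ≥0∞ := κ.mom β 2 / κ.mom β 1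

/-- The tail `P_β(|K| ≥ n)` of the cluster volume. -/
noncomputable def tailP (β : ℝ) (n : ℕ) : ℝ≥0∞ :=
  ⨆ μ ∈ {μ : Measure (Config d) | IsPerc μ (κ.edgeP β)},
    μ {ω | (n : ℝ≥0∞) ≤ eCard (cluster ω (0 : V d))}

/-- The `L^p` radius of gyration `ξ_p(β)` (for the full kernel). -/
noncomputable def xiFull (β : ℝ) (p : ℝ) : ℝ≥0∞ :=
  ⨆ μ ∈ {μ : Measure (Config d) | IsPerc μ (κ.edgeP β)}, xi μ p

/-- The `p`-th moment `E_{β,r} |K|^p` for the cut-off kernel. -/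
noncomputable def momCut (β r : ℝ) (p : ℕ) : ℝ≥0∞ :=
  ⨆ μ ∈ {μ : Measure (Config d) | IsPerc μ (κ.edgePCut β r)}, clMom μ p

/-- `ξ*(β) = χ(β)^{1/α}`. -/
noncomputable def xiStar (β : ℝ) : ℝ := (κ.chi β).toReal ^ α⁻¹

/-- `ζ*(β) = ζ(β_c, ξ*(β))`, where `ζ(β,r) = E_{β,r}|K|²/E_{β,r}|K|`. -/
noncomputable def zetaStar (β : ℝ) : ℝ :=
  (κ.momCut κ.betaC (κ.xiStar β) 2 / κ.momCut κ.betaC (κ.xiStar β) 1).toReal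

/-- The edian `M_r` of the maximal cluster volume in `B_r` under `P_{β_c, r}`. -/
noncomputable def MrCut (r : ℝ) : ℕ :=
  sInf {n : ℕ | ∀ μ : Measure (Config d), IsPerc μ (κ.edgePCut κ.betaC r) →
    μ {ω | ∃ x : V d, (n : ℝ≥0∞) ≤ eCard (cluster ω x ∩ κ.ball r)} ≤
      ENNReal.ofReal (Real.exp (-1))}

/-- The edian `M_r^*` of the maximal cluster volume in `B_r` under `P_{β_c}`. -/
noncomputable def MrFull (r : ℝ) : ℕ :=
  sInf {n : ℕ | ∀ μ : Measure (Config d), IsPerc μ (κ.edgeP κ.betaC) →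
    μ {ω | ∃ x : V d, (n : ℝ≥0∞) ≤ eCard (cluster ω x ∩ κ.ball r)} ≤
      ENNReal.ofReal (Real.exp (-1))}

/-- `f(β) = |β - β_c|^{-c ± o(1)}` as `β ↑ β_c`, i.e. the critical exponent of `f`
at `β_c` is well-defined and equal to `c`. -/
def HasExp (f : ℝ → ℝ≥0∞) (c : ℝ) : Prop :=
  Tendsto (fun β => Real.log (f β).toReal / Real.log (1 / (κ.betaC - β)))
    (nhdsWithin κ.betaC (Set.Iio κ.betaC)) (nhds c)

end Kernel

end LRP

namespace LRP

/-! ## Independent edges on a finite edge set -/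

section FiniteProduct

variable {E : Type*} [DecidableEq E]

/-- The probability that, among the edges of `R`, exactly those of `ξ` are open. -/
noncomputable def wt (p : E → ℝ) (R ξ : Finset E) : ℝ := ∏ e ∈ R, if e ∈ ξ then p e else 1 - p e

/-- The expectation of `f` of the set of open edges of `R`. -/
noncomputable def expect (p : E → ℝ) (R : Finset E) (f : Finset E → ℝ) : ℝ :=
  ∑ ξ ∈ R.powerset, wt p R ξ * f ξ

/-- The expectation of `g` of two independent sets of open edges of `R`. -/
noncomputable def expect₂ (p : E → ℝ) (R : Finset E) (g : Finset E → Finset E → ℝ) : ℝ :=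
  expect p R fun ξ => expect p R fun η => g ξ η

/-- The indicator of a proposition. -/
noncomputable def ind (P : Prop) : ℝ := if P then 1 else 0

theorem ind_of {P : Prop} (h : P) : ind P = 1 := if_pos h

theorem ind_of_not {P : Prop} (h : ¬P) : ind P = 0 := if_neg h

theorem ind_nonneg (P : Prop) : 0 ≤ ind P := by
  unfold ind; split_ifs <;> norm_num

theorem ind_mono {P Q : Prop} (h : P → Q) : ind P ≤ ind Q := by
  unfold ind; split_ifs with h₁ h₂
  · exact le_rfl
  · exact absurd (h h₁) h₂
  · exact zero_le_one
  · exact le_rfl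

variable {p : E → ℝ}

theorem wt_nonneg (h0 : ∀ e, 0 ≤ p e) (h1 : ∀ e, p e ≤ 1) (R ξ : Finset E) : 0 ≤ wt p R ξ :=
  Finset.prod_nonneg fun e _ => by
    split_ifs
    · exact h0 e
    · linarith [h1 e]

theorem expect_insert {R : Finset E} {e : E} (he : e ∉ R) (f : Finset E → ℝ) :
    expect p (insert e R) f =
      (1 - p e) * expect p R f + p e * expect p R fun ξ => f (insert e ξ) := by
  unfold expect
  rw [Finset.sum_powerset_insert he, Finset.mul_sum, Finset.mul_sum]
  congr 1
  · refine Finset.sum_congr rfl fun ξ hξ => ?_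
    have : e ∉ ξ := fun h => he (Finset.mem_powerset.1 hξ h)
    simp [wt, Finset.prod_insert he, this, mul_assoc]
  · refine Finset.sum_congr rfl fun ξ hξ => ?_
    have : wt p R (insert e ξ) = wt p R ξ := by
      refine Finset.prod_congr rfl fun x hx => ?_
      have : x ≠ e := fun h => he (h ▸ hx)
      simp [this]
    rw [← mul_assoc, ← this]
    simp [wt, Finset.prod_insert he]

theorem expect_mono (h0 : ∀ e, 0 ≤ p e) (h1 : ∀ e, p e ≤ 1) {R : Finset E} {f g : Finset E → ℝ}
    (h : ∀ ξ ⊆ R, f ξ ≤ g ξ) : expect p R f ≤ expect p R g :=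
  Finset.sum_le_sum fun ξ hξ =>
    mul_le_mul_of_nonneg_left (h ξ (Finset.mem_powerset.1 hξ)) (wt_nonneg h0 h1 R ξ)

theorem expect_nonneg (h0 : ∀ e, 0 ≤ p e) (h1 : ∀ e, p e ≤ 1) {R : Finset E} {f : Finset E → ℝ}
    (h : ∀ ξ ⊆ R, 0 ≤ f ξ) : 0 ≤ expect p R f :=
  Finset.sum_nonneg fun ξ hξ =>
    mul_nonneg (wt_nonneg h0 h1 R ξ) (h ξ (Finset.mem_powerset.1 hξ))

theorem expect_congr {R : Finset E} {f g : Finset E → ℝ} (h : ∀ ξ ⊆ R, f ξ = g ξ) :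
    expect p R f = expect p R g :=
  Finset.sum_congr rfl fun ξ hξ => by rw [h ξ (Finset.mem_powerset.1 hξ)]

theorem expect_const (R : Finset E) (c : ℝ) : expect p R (fun _ => c) = c := by
  induction R using Finset.induction_on with
  | empty => simp [expect, wt]
  | insert e R he ih => rw [expect_insert he, ih]; ring

theorem expect_add (R : Finset E) (f g : Finset E → ℝ) :
    expect p R (fun ξ => f ξ + g ξ) = expect p R f + expect p R g := by
  simp only [expect, mul_add, Finset.sum_add_distrib]

theorem expect_const_mul (R : Finset E) (c : ℝ) (f : Finset E → ℝ) :
    expect p R (fun ξ => c * f ξ) = c * expect p R f := by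
  simp only [expect, Finset.mul_sum]
  exact Finset.sum_congr rfl fun _ _ => by ring

theorem expect_sum {ι : Type*} (s : Finset ι) (R : Finset E) (f : ι → Finset E → ℝ) :
    expect p R (fun ξ => ∑ i ∈ s, f i ξ) = ∑ i ∈ s, expect p R (f i) := by
  simp only [expect, Finset.mul_sum]
  exact Finset.sum_comm

theorem expect₂_mul (R : Finset E) (f g : Finset E → ℝ) :
    expect₂ p R (fun ξ η => f ξ * g η) = expect p R f * expect p R g := by
  simp only [expect₂, expect_const_mul]
  simp only [mul_comm _ (expect p R g), expect_const_mul]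

theorem expect₂_mono (h0 : ∀ e, 0 ≤ p e) (h1 : ∀ e, p e ≤ 1) {R : Finset E}
    {f g : Finset E → Finset E → ℝ} (h : ∀ ξ ⊆ R, ∀ η ⊆ R, f ξ η ≤ g ξ η) :
    expect₂ p R f ≤ expect₂ p R g :=
  expect_mono h0 h1 fun ξ hξ => expect_mono h0 h1 fun η hη => h ξ hξ η hη

theorem expect₂_nonneg (h0 : ∀ e, 0 ≤ p e) (h1 : ∀ e, p e ≤ 1) {R : Finset E}
    {f : Finset E → Finset E → ℝ} (h : ∀ ξ η, 0 ≤ f ξ η) : 0 ≤ expect₂ p R f :=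
  expect_nonneg h0 h1 fun ξ _ => expect_nonneg h0 h1 fun η _ => h ξ η

theorem expect₂_add (R : Finset E) (f g : Finset E → Finset E → ℝ) :
    expect₂ p R (fun ξ η => f ξ η + g ξ η) = expect₂ p R f + expect₂ p R g := by
  simp only [expect₂, expect_add]

theorem expect₂_const_mul (R : Finset E) (c : ℝ) (f : Finset E → Finset E → ℝ) :
    expect₂ p R (fun ξ η => c * f ξ η) = c * expect₂ p R f := by
  simp only [expect₂, expect_const_mul]

theorem expect₂_insert {R : Finset E} {e : E} (he : e ∉ R) (g : Finset E → Finset E → ℝ) :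
    expect₂ p (insert e R) g =
      expect₂ p R fun ξ η =>
        (1 - p e) * ((1 - p e) * g ξ η + p e * g ξ (insert e η)) +
          p e * ((1 - p e) * g (insert e ξ) η + p e * g (insert e ξ) (insert e η)) := by
  simp only [expect₂, expect_insert he, expect_add, expect_const_mul]

/-- Both `ξ` and `η`, enlarged by disjoint parts of the shared edge set `O`, satisfy `U`. -/
def Shared (U : Finset E → Finset E → Prop) (O ξ η : Finset E) : Prop :=
  ∃ O₁ O₂, O₁ ⊆ O ∧ O₂ ⊆ O ∧ Disjoint O₁ O₂ ∧ U (O₁ ∪ ξ) (O₂ ∪ η)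

theorem ind_resample_le {r : ℝ} (h0 : 0 ≤ r) (h1 : r ≤ 1) {H P₀₀ P₁₀ P₀₁ P₁₁ : Prop}
    (hH : H → P₁₀ ∨ P₀₁) (h₁₀ : P₀₀ → P₁₀) (h₀₁ : P₀₀ → P₀₁) (h : P₁₀ → P₁₁) (h' : P₀₁ → P₁₁) :
    (1 - r) * ind P₀₀ + r * ind H ≤
      (1 - r) * ((1 - r) * ind P₀₀ + r * ind P₀₁) + r * ((1 - r) * ind P₁₀ + r * ind P₁₁) := by
  have hn := mul_nonneg h0 (sub_nonneg.2 h1)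
  by_cases hP₀₀ : P₀₀
  · rw [ind_of hP₀₀, ind_of (h₁₀ hP₀₀), ind_of (h₀₁ hP₀₀), ind_of (h (h₁₀ hP₀₀))]
    have : ind H ≤ 1 := ind_of trivial ▸ ind_mono fun _ : H => trivial
    nlinarith
  · rw [ind_of_not hP₀₀]
    by_cases hP₁₀ : P₁₀
    · rw [ind_of hP₁₀, ind_of (h hP₁₀)]
      have : ind H ≤ 1 := ind_of trivial ▸ ind_mono fun _ : H => trivial
      nlinarith [mul_nonneg hn (ind_nonneg P₀₁)]
    · by_cases hP₀₁ : P₀₁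
      · rw [ind_of hP₀₁, ind_of (h' hP₀₁)]
        have : ind H ≤ 1 := ind_of trivial ▸ ind_mono fun _ : H => trivial
        nlinarith [mul_nonneg hn (ind_nonneg P₁₀)]
      · rw [ind_of_not fun hh => (hH hh).elim hP₁₀ hP₀₁]
        nlinarith [mul_nonneg hn (ind_nonneg P₁₀), mul_nonneg hn (ind_nonneg P₀₁),
          mul_nonneg (mul_nonneg h0 h0) (ind_nonneg P₁₁)]

/-- Replacing an edge shared by two copies by independent edges increases the probability of
disjointly satisfying an increasing property, as in the van den Berg–Kesten inequality. -/
theorem expect₂_shared_le (h0 : ∀ e, 0 ≤ p e) (h1 : ∀ e, p e ≤ 1)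
    {U : Finset E → Finset E → Prop}
    (hU : ∀ ξ ξ' η η', ξ ⊆ ξ' → η ⊆ η' → U ξ η → U ξ' η') {R : Finset E} {e : E} (he : e ∉ R)
    (O : Finset E) :
    (1 - p e) * expect₂ p R (fun ξ η => ind (Shared U O ξ η)) +
        p e * expect₂ p R (fun ξ η => ind (Shared U (insert e O) ξ η)) ≤
      expect₂ p (insert e R) fun ξ η => ind (Shared U O ξ η) := by
  rw [expect₂_insert he, ← expect₂_const_mul, ← expect₂_const_mul, ← expect₂_add]
  refine expect₂_mono h0 h1 fun ξ _ η _ => ?_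
  have mono : ∀ ξ ξ' η η', ξ ⊆ ξ' → η ⊆ η' → Shared U O ξ η → Shared U O ξ' η' := by
    rintro ξ ξ' η η' h h' ⟨O₁, O₂, hO₁, hO₂, hd, hu⟩
    exact ⟨O₁, O₂, hO₁, hO₂, hd, hU _ _ _ _ (Finset.union_subset_union_right h)
      (Finset.union_subset_union_right h') hu⟩
  have split : Shared U (insert e O) ξ η →
      Shared U O (insert e ξ) η ∨ Shared U O ξ (insert e η) := by
    rintro ⟨O₁, O₂, hO₁, hO₂, hd, hu⟩
    have aux : ∀ {X : Finset E}, X ⊆ insert e O → X.erase e ⊆ O := fun h x hx => by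
      have := h (Finset.mem_of_mem_erase hx)
      simpa [Finset.ne_of_mem_erase hx] using this
    have aux' : ∀ {X Y : Finset E}, X ∪ Y ⊆ X.erase e ∪ insert e Y := by
      intro X Y x hx
      by_cases h : x = e <;> simp_all
    by_cases h : e ∈ O₁
    · have h2 : e ∉ O₂ := Finset.disjoint_left.1 hd h
      refine Or.inl ⟨O₁.erase e, O₂, aux hO₁, ?_, hd.mono_left (Finset.erase_subset _ _),
        hU _ _ _ _ aux' subset_rfl hu⟩
      simpa [Finset.erase_eq_of_notMem h2] using aux hO₂
    · refine Or.inr ⟨O₁, O₂.erase e, ?_, aux hO₂, hd.mono_right (Finset.erase_subset _ _),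
        hU _ _ _ _ subset_rfl aux' hu⟩
      simpa [Finset.erase_eq_of_notMem h] using aux hO₁
  have hp := h0 e
  have hq := h1 e
  have m1 := mono ξ (insert e ξ) η η (Finset.subset_insert _ _) subset_rfl
  have m2 := mono ξ ξ η (insert e η) subset_rfl (Finset.subset_insert _ _)
  have m3 := mono (insert e ξ) (insert e ξ) η (insert e η) subset_rfl (Finset.subset_insert _ _)
  have m4 := mono ξ (insert e ξ) (insert e η) (insert e η) (Finset.subset_insert _ _) subset_rfl
  exact ind_resample_le hp hq split m1 m2 m3 m4

/-- The Cauchy–Schwarz inequality for two-point probability measures. -/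
theorem convex_comb_sqrt_mul_le {q r y₀ y₁ z₀ z₁ : ℝ} (hq : 0 ≤ q) (hr : 0 ≤ r) (hy₀ : 0 ≤ y₀)
    (hy₁ : 0 ≤ y₁) (hz₀ : 0 ≤ z₀) (hz₁ : 0 ≤ z₁) :
    q * √(y₀ * z₀) + r * √(y₁ * z₁) ≤ √((q * y₀ + r * y₁) * (q * z₀ + r * z₁)) := by
  apply Real.le_sqrt_of_sq_le
  rw [Real.sqrt_mul hy₀, Real.sqrt_mul hy₁]
  have e1 := Real.sq_sqrt hy₀
  have e2 := Real.sq_sqrt hy₁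
  have e3 := Real.sq_sqrt hz₀
  have e4 := Real.sq_sqrt hz₁
  generalize √y₀ = a at *
  generalize √y₁ = b at *
  generalize √z₀ = c at *
  generalize √z₁ = d at *
  subst e1 e2 e3 e4
  nlinarith [mul_nonneg (mul_nonneg hq hr) (sq_nonneg (a * d - b * c))]

end FiniteProduct

/-! ## Depth-first exploration -/

section Exploration

variable {Vt : Type*}

/-- The vertices `x` and `y` are joined by a path of edges of `ω`. -/
def Linked (ω : Finset (Sym2 Vt)) (x y : Vt) : Prop :=
  Relation.ReflTransGen (fun a b => s(a, b) ∈ ω) x y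

/-- All vertices of `B` are joined to each other by paths of edges of `ω`. -/
def Joined (ω : Finset (Sym2 Vt)) (B : Finset Vt) : Prop := ∀ x ∈ B, ∀ y ∈ B, Linked ω x y

theorem Linked.mono {ω ω' : Finset (Sym2 Vt)} (h : ω ⊆ ω') {x y : Vt} (hxy : Linked ω x y) :
    Linked ω' x y :=
  Relation.ReflTransGen.mono (fun _ _ hab => h hab) _ _ hxy

theorem Linked.symm {ω : Finset (Sym2 Vt)} {x y : Vt} (h : Linked ω x y) : Linked ω y x := by
  induction h with
  | refl => exact Relation.ReflTransGen.refl
  | @tail y z _ hyz ih => exact Relation.ReflTransGen.head (by rwa [Sym2.eq_swap]) ih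

theorem Linked.trans {ω : Finset (Sym2 Vt)} {x y z : Vt} (h : Linked ω x y) (h' : Linked ω y z) :
    Linked ω x z :=
  Relation.ReflTransGen.trans h h'

theorem Linked.of_mem {ω : Finset (Sym2 Vt)} {x y : Vt} (h : s(x, y) ∈ ω) : Linked ω x y :=
  Relation.ReflTransGen.single h

theorem Joined.mono {ω ω' : Finset (Sym2 Vt)} {B B' : Finset Vt} (h : ω ⊆ ω') (hB : B' ⊆ B)
    (hω : Joined ω B) : Joined ω' B' :=
  fun x hx y hy => (hω x (hB hx) y (hB hy)).mono h

theorem Joined.insert {ω : Finset (Sym2 Vt)} {B : Finset Vt} (h : Joined ω B) {u w : Vt}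
    (hu : u ∈ B) (huw : Linked ω u w) : Joined ω (insert w B) := by
  have key : ∀ x ∈ Insert.insert w B, Linked ω x u := by
    intro x hx
    rcases Finset.mem_insert.1 hx with rfl | hx
    · exact huw.symm
    · exact h x hx u hu
  exact fun x hx y hy => (key x hx).trans (key y hy).symm

/-- `Explored a O W S` says that a depth-first exploration started at `a` can have visited the
vertices of `W` through the open edges of `O`, with `S` the current stack of vertices (possibly
after popping some). -/
inductive Explored (a : Vt) : Finset (Sym2 Vt) → Finset Vt → List Vt → Prop
  | start : Explored a ∅ {a} [a]
  | push {O W v S} (w : Vt) : Explored a O W (v :: S) → w ∉ W →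
      Explored a (insert s(v, w) O) (insert w W) (w :: v :: S)
  | pop {O W v S} : Explored a O W (v :: S) → Explored a O W S

namespace Explored

variable {a : Vt} {O : Finset (Sym2 Vt)} {W : Finset Vt} {S : List Vt}

theorem stack_subset (h : Explored a O W S) : ∀ x ∈ S, x ∈ W := by
  induction h with
  | start => simp
  | push w _ _ ih =>
    intro x hx
    rcases List.mem_cons.1 hx with rfl | hx
    · simp
    · exact Finset.mem_insert_of_mem (ih x hx)
  | pop _ ih => exact fun x hx => ih x (List.mem_cons_of_mem _ hx)

theorem start_mem (h : Explored a O W S) : a ∈ W := by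
  induction h with
  | start => simp
  | push w _ _ ih => exact Finset.mem_insert_of_mem ih
  | pop _ ih => exact ih

theorem getLast_eq (h : Explored a O W S) (hS : S ≠ []) : S.getLast hS = a := by
  induction h with
  | start => rfl
  | push w _ _ ih => rw [List.getLast_cons (List.cons_ne_nil _ _)]; exact ih _
  | pop _ ih => rw [← ih (List.cons_ne_nil _ _), List.getLast_cons hS]

theorem joined (h : Explored a O W S) : Joined O W := by
  induction h with
  | start =>
    intro x hx y hy
    rw [Finset.mem_singleton.1 hx, Finset.mem_singleton.1 hy]
    exact Relation.ReflTransGen.refl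
  | push w h _ ih =>
    exact (ih.mono (Finset.subset_insert _ _) subset_rfl).insert
      (h.stack_subset _ List.mem_cons_self) (Linked.of_mem (Finset.mem_insert_self _ _))
  | pop _ ih => exact ih

theorem mem_of_edge (h : Explored a O W S) : ∀ x y, s(x, y) ∈ O → x ∈ W := by
  induction h with
  | start => simp
  | @push O W v S w h _ ih =>
    intro x y hxy
    rcases Finset.mem_insert.1 hxy with hxy | hxy
    · rcases Sym2.eq_iff.1 hxy with ⟨rfl, rfl⟩ | ⟨rfl, rfl⟩
      · exact Finset.mem_insert_of_mem (h.stack_subset _ List.mem_cons_self)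
      · exact Finset.mem_insert_self _ _
    · exact Finset.mem_insert_of_mem (ih x y hxy)
  | pop _ ih => exact ih

/-- Removing an edge `s(x, y)` of the stack splits the explored tree into two pieces. -/
theorem split (h : Explored a O W S) : ∀ l₁ x y l₂, S = l₁ ++ x :: y :: l₂ →
    ∃ O₁ O₂ W₁ W₂, O₁ ⊆ O ∧ O₂ ⊆ O ∧ Disjoint O₁ O₂ ∧ W₁ ∪ W₂ = W ∧ Disjoint W₁ W₂ ∧
      Joined O₁ W₁ ∧ Joined O₂ W₂ ∧ (∀ z ∈ y :: l₂, z ∈ W₁) ∧ (∀ z ∈ l₁ ++ [x], z ∈ W₂) ∧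
      s(x, y) ∈ O ∧ s(x, y) ∉ O₁ ∧ s(x, y) ∉ O₂ := by
  induction h with
  | start =>
    intro l₁ x y l₂ h
    have := congrArg List.length h
    simp at this
    omega
  | @push O W v S w h hw ih =>
    intro l₁ x y l₂ hS
    have hnew : ∀ z, s(v, w) ∉ O ∧ s(z, w) ∉ O ∧ s(w, z) ∉ O := by
      intro z
      have h1 : ∀ z, s(w, z) ∉ O := fun z hz => hw (h.mem_of_edge _ _ hz)
      exact ⟨by rw [Sym2.eq_swap]; exact h1 _, by rw [Sym2.eq_swap]; exact h1 _, h1 _⟩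
    rcases l₁ with _ | ⟨b, l₁⟩
    · simp only [List.nil_append, List.cons.injEq] at hS
      obtain ⟨rfl, rfl, rfl⟩ := hS
      refine ⟨O, ∅, W, {w}, Finset.subset_insert _ _, by simp, by simp, ?_, by simpa using hw,
        h.joined, ?_, h.stack_subset, by simp, ?_, ?_, by simp⟩
      · rw [Finset.union_comm]; rfl
      · intro x hx y hy
        rw [Finset.mem_singleton.1 hx, Finset.mem_singleton.1 hy]
        exact Relation.ReflTransGen.refl
      · rw [Sym2.eq_swap]; exact Finset.mem_insert_self _ _
      · exact (hnew _).2.2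
    · simp only [List.cons_append, List.cons.injEq] at hS
      obtain ⟨rfl, hS⟩ := hS
      obtain ⟨O₁, O₂, W₁, W₂, hO₁, hO₂, hd, hW, hWd, hJ₁, hJ₂, hm₁, hm₂, he, he₁, he₂⟩ :=
        ih l₁ x y l₂ hS
      have hv : v ∈ W₂ := by
        apply hm₂
        rcases l₁ with _ | ⟨b, l₁⟩
        · simp only [List.nil_append, List.cons.injEq] at hS
          simp [hS.1]
        · simp only [List.cons_append, List.cons.injEq] at hS
          simp [hS.1]
      refine ⟨O₁, Insert.insert s(v, w) O₂, W₁, Insert.insert w W₂,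
        hO₁.trans (Finset.subset_insert _ _), Finset.insert_subset_insert _ hO₂, ?_, ?_, ?_, hJ₁, ?_,
        hm₁, ?_, Finset.mem_insert_of_mem he, he₁, ?_⟩
      · rw [Finset.disjoint_insert_right]
        exact ⟨fun hh => (hnew v).1 (hO₁ hh), hd⟩
      · rw [Finset.union_insert, hW]
      · rw [Finset.disjoint_insert_right]
        exact ⟨fun hh => hw (hW ▸ Finset.mem_union_left _ hh), hWd⟩
      · exact (hJ₂.mono (Finset.subset_insert _ _) subset_rfl).insert hv
          (Linked.of_mem (Finset.mem_insert_self _ _))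
      · intro z hz
        rcases List.mem_cons.1 hz with rfl | hz
        · exact Finset.mem_insert_self _ _
        · exact Finset.mem_insert_of_mem (hm₂ z hz)
      · intro hh
        rcases Finset.mem_insert.1 hh with hh | hh
        · exact (hnew v).1 (hh ▸ he)
        · exact he₂ hh
  | @pop O W v S h ih =>
    intro l₁ x y l₂ hS
    obtain ⟨O₁, O₂, W₁, W₂, hO₁, hO₂, hd, hW, hWd, hJ₁, hJ₂, hm₁, hm₂, he⟩ :=
      ih (v :: l₁) x y l₂ (by rw [hS]; rfl)
    exact ⟨O₁, O₂, W₁, W₂, hO₁, hO₂, hd, hW, hWd, hJ₁, hJ₂, hm₁,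
      fun z hz => hm₂ z (List.mem_cons_of_mem _ hz), he⟩

/-- Two stack vertices `u` and `v` can be attached to disjoint pieces of the explored tree,
one of which contains the starting vertex and the other one the top of the stack. -/
theorem split_of_mem {b : Vt} (h : Explored a O W (b :: S)) (hS : S ≠ []) {u v : Vt}
    (hu : u ∈ b :: S) (hv : v ∈ b :: S) :
    ∃ O₁ O₂ W₁ W₂, O₁ ⊆ O ∧ O₂ ⊆ O ∧ Disjoint O₁ O₂ ∧ W₁ ∪ W₂ = W ∧ Disjoint W₁ W₂ ∧
      Joined O₁ (insert u W₁) ∧ Joined O₂ (insert v W₂) ∧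
      (a ∈ W₁ ∧ b ∈ W₂ ∨ b ∈ W₁ ∧ a ∈ W₂) := by
  have top : ∀ l₁ x l, b :: S = l₁ ++ x :: l → b ∈ l₁ ++ [x] := by
    intro l₁ x l hh
    rcases l₁ with _ | ⟨c, l₁⟩
    · simp only [List.nil_append, List.cons.injEq] at hh
      simp [hh.1]
    · simp only [List.cons_append, List.cons.injEq] at hh
      simp [hh.1]
  have bot : ∀ l₁ x y l, b :: S = l₁ ++ x :: y :: l → a ∈ y :: l := by
    intro l₁ x y l hh
    have := h.getLast_eq (List.cons_ne_nil _ _)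
    simp only [hh] at this
    rw [List.getLast_append_of_ne_nil _ (List.cons_ne_nil _ _),
      List.getLast_cons (List.cons_ne_nil _ _)] at this
    rw [← this]
    exact List.getLast_mem _
  by_cases huv : u = v
  · subst huv
    obtain ⟨l₁, l₂, hl⟩ := List.append_of_mem hu
    rcases List.eq_nil_or_concat l₁ with rfl | ⟨l₁, x, rfl⟩
    · obtain ⟨y, l₂, rfl⟩ : ∃ y l, l₂ = y :: l := by
        rcases l₂ with _ | ⟨y, l⟩
        · simp at hl; exact absurd hl.2 hS
        · exact ⟨y, l, rfl⟩
      obtain ⟨O₁, O₂, W₁, W₂, hO₁, hO₂, hd, hW, hWd, hJ₁, hJ₂, hm₁, hm₂, he, he₁, he₂⟩ :=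
        h.split _ _ _ _ hl
      refine ⟨insert s(u, y) O₁, O₂, W₁, W₂, Finset.insert_subset he hO₁, hO₂, ?_, hW, hWd, ?_, ?_,
        Or.inl ⟨hm₁ _ (bot _ _ _ _ hl), hm₂ _ (top _ _ _ hl)⟩⟩
      · rw [Finset.disjoint_insert_left]; exact ⟨he₂, hd⟩
      · exact (hJ₁.mono (Finset.subset_insert _ _) subset_rfl).insert (hm₁ y (by simp))
          (Linked.of_mem (Finset.mem_insert_self _ _)).symm
      · rwa [Finset.insert_eq_of_mem (hm₂ u (by simp))]
    · have hl' : b :: S = l₁ ++ x :: u :: l₂ := by simpa using hl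
      obtain ⟨O₁, O₂, W₁, W₂, hO₁, hO₂, hd, hW, hWd, hJ₁, hJ₂, hm₁, hm₂, he, he₁, he₂⟩ :=
        h.split _ _ _ _ hl'
      refine ⟨O₁, insert s(x, u) O₂, W₁, W₂, hO₁, Finset.insert_subset he hO₂, ?_, hW, hWd, ?_, ?_,
        Or.inl ⟨hm₁ _ (bot _ _ _ _ hl'), hm₂ _ (top _ _ _ hl')⟩⟩
      · rw [Finset.disjoint_insert_right]; exact ⟨he₁, hd⟩
      · rwa [Finset.insert_eq_of_mem (hm₁ u (by simp))]
      · exact (hJ₂.mono (Finset.subset_insert _ _) subset_rfl).insert (hm₂ x (by simp))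
          (Linked.of_mem (Finset.mem_insert_self _ _))
  · obtain ⟨l₁, l₂, hl⟩ := List.append_of_mem hu
    have hv' : v ∈ l₁ ∨ v ∈ l₂ := by
      rw [hl] at hv
      simpa [Ne.symm huv] using hv
    rcases hv' with hv' | hv'
    · rcases List.eq_nil_or_concat l₁ with rfl | ⟨l₁, x, rfl⟩
      · simp at hv'
      · have hl' : b :: S = l₁ ++ x :: u :: l₂ := by simpa using hl
        obtain ⟨O₁, O₂, W₁, W₂, hO₁, hO₂, hd, hW, hWd, hJ₁, hJ₂, hm₁, hm₂, -⟩ :=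
          h.split _ _ _ _ hl'
        refine ⟨O₁, O₂, W₁, W₂, hO₁, hO₂, hd, hW, hWd, ?_, ?_,
          Or.inl ⟨hm₁ _ (bot _ _ _ _ hl'), hm₂ _ (top _ _ _ hl')⟩⟩
        · rwa [Finset.insert_eq_of_mem (hm₁ u (by simp))]
        · rwa [Finset.insert_eq_of_mem (hm₂ v (by simpa using hv'))]
    · rcases l₂ with _ | ⟨y, l₂⟩
      · simp at hv'
      · obtain ⟨O₁, O₂, W₁, W₂, hO₁, hO₂, hd, hW, hWd, hJ₁, hJ₂, hm₁, hm₂, -⟩ :=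
          h.split _ _ _ _ hl
        refine ⟨O₂, O₁, W₂, W₁, hO₂, hO₁, hd.symm, by rw [Finset.union_comm, hW], hWd.symm, ?_, ?_,
          Or.inr ⟨hm₂ _ (top _ _ _ hl), hm₁ _ (bot _ _ _ _ hl)⟩⟩
        · rwa [Finset.insert_eq_of_mem (hm₂ u (by simp))]
        · rwa [Finset.insert_eq_of_mem (hm₁ v hv')]

/-- A vertex outside the explored region that is joined to it by unexplored edges is joined
to the stack outside of the explored region. -/
theorem exists_linked_stack (h : Explored a O W S) {R ξ : Finset (Sym2 Vt)} (hξ : ξ ⊆ R)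
    (hR : ∀ x ∈ W, ∀ y ∉ W, s(x, y) ∈ R → x ∈ S) {c x : Vt} (hc : c ∉ W) (hx : x ∈ W)
    (hcx : Linked (O ∪ ξ) c x) : ∃ u ∈ S, Linked ξ c u := by
  have key : ∀ x, Linked (O ∪ ξ) c x → (Linked ξ c x ∧ x ∉ W) ∨ ∃ u ∈ S, Linked ξ c u := by
    intro x hcx
    induction hcx with
    | refl => exact Or.inl ⟨Relation.ReflTransGen.refl, hc⟩
    | @tail x y _ hxy ih =>
      rcases ih with ⟨hl, hxW⟩ | hh
      · have hξ' : s(x, y) ∈ ξ := by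
          rcases Finset.mem_union.1 hxy with hh | hh
          · exact absurd (h.mem_of_edge _ _ hh) hxW
          · exact hh
        have hly : Linked ξ c y := hl.trans (Linked.of_mem hξ')
        by_cases hy : y ∈ W
        · refine Or.inr ⟨y, hR y hy x hxW (hξ ?_), hly⟩
          rwa [Sym2.eq_swap]
        · exact Or.inl ⟨hly, hy⟩
      · exact Or.inr hh
  rcases key x hcx with ⟨_, hh⟩ | hh
  · exact absurd hx hh
  · exact hh

end Explored

/-- The vertices of `A` other than `c` can be divided into two nonempty classes, the first of which
is joined to `c` in `ξ` and the second one in `η`. -/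
def SplitJoined (A : Finset Vt) (c : Vt) (ξ η : Finset (Sym2 Vt)) : Prop :=
  ∃ B ⊆ A.erase c, B.Nonempty ∧ (A.erase c \ B).Nonempty ∧
    Joined ξ (insert c B) ∧ Joined η (insert c (A.erase c \ B))

theorem SplitJoined.mono {A : Finset Vt} {c : Vt} (ξ ξ' η η' : Finset (Sym2 Vt)) (h : ξ ⊆ ξ')
    (h' : η ⊆ η') : SplitJoined A c ξ η → SplitJoined A c ξ' η' := by
  rintro ⟨B, hB, hB₁, hB₂, hJ₁, hJ₂⟩
  exact ⟨B, hB, hB₁, hB₂, hJ₁.mono h subset_rfl, hJ₂.mono h' subset_rfl⟩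

theorem Explored.shared_splitJoined {a b c : Vt} {O : Finset (Sym2 Vt)} {W A : Finset Vt}
    {S : List Vt} (h : Explored a O W (b :: S)) (hS : S ≠ []) (ha : a ∈ A) (hb : b ∈ A)
    (hc : A \ W = {c}) {R ξ η : Finset (Sym2 Vt)} (hξ : ξ ⊆ R) (hη : η ⊆ R)
    (hR : ∀ x ∈ W, ∀ y ∉ W, s(x, y) ∈ R → x ∈ b :: S)
    (hJξ : Joined (O ∪ ξ) A) (hJη : Joined (O ∪ η) A) :
    Shared (SplitJoined A c) O ξ η := by
  have hc' : c ∈ A \ W := by rw [hc]; simp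
  obtain ⟨hcA, hcW⟩ := Finset.mem_sdiff.1 hc'
  have hcov : ∀ x ∈ A, x ≠ c → x ∈ W := by
    intro x hx hxc
    by_contra hxW
    have : x ∈ A \ W := Finset.mem_sdiff.2 ⟨hx, hxW⟩
    rw [hc] at this
    exact hxc (Finset.mem_singleton.1 this)
  obtain ⟨u, huS, hu⟩ := h.exists_linked_stack hξ hR hcW h.start_mem (hJξ c hcA a ha)
  obtain ⟨v, hvS, hv⟩ := h.exists_linked_stack hη hR hcW h.start_mem (hJη c hcA a ha)
  obtain ⟨O₁, O₂, W₁, W₂, hO₁, hO₂, hd, hW, hWd, hJ₁, hJ₂, hab⟩ := h.split_of_mem hS huS hvS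
  have hsub : ∀ x ∈ W₁, x ≠ c := by
    rintro x hx rfl
    exact hcW (hW ▸ Finset.mem_union_left _ hx)
  have hsub2 : ∀ x ∈ W₂, x ≠ c := by
    rintro x hx rfl
    exact hcW (hW ▸ Finset.mem_union_right _ hx)
  have hB₂ : A.erase c \ (A ∩ W₁) = A ∩ W₂ := by
    ext x
    simp only [Finset.mem_sdiff, Finset.mem_erase, Finset.mem_inter, not_and]
    constructor
    · rintro ⟨⟨hxc, hxA⟩, hx⟩
      have := hcov x hxA hxc
      rw [← hW] at this
      exact ⟨hxA, (Finset.mem_union.1 this).resolve_left (hx hxA)⟩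
    · rintro ⟨hxA, hx⟩
      exact ⟨⟨hsub2 x hx, hxA⟩, fun _ hx' => Finset.disjoint_left.1 hWd hx' hx⟩
  have attach : ∀ {O' ω : Finset (Sym2 Vt)} {W' : Finset Vt} {w : Vt},
      Joined O' (insert w W') → Linked ω c w → Joined (O' ∪ ω) (insert c (A ∩ W')) := by
    intro O' ω W' w hJ hl
    refine ((hJ.mono Finset.subset_union_left subset_rfl).insert (Finset.mem_insert_self _ _)
      (hl.symm.mono Finset.subset_union_right)).mono subset_rfl ?_
    intro x hx
    simp only [Finset.mem_insert, Finset.mem_inter] at hx ⊢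
    tauto
  refine ⟨O₁, O₂, hO₁, hO₂, hd, A ∩ W₁, ?_, ?_, ?_, attach hJ₁ hu, ?_⟩
  · intro x hx
    rw [Finset.mem_inter] at hx
    exact Finset.mem_erase.2 ⟨hsub x hx.2, hx.1⟩
  · rcases hab with hab | hab
    · exact ⟨a, Finset.mem_inter.2 ⟨ha, hab.1⟩⟩
    · exact ⟨b, Finset.mem_inter.2 ⟨hb, hab.1⟩⟩
  · rw [hB₂]
    rcases hab with hab | hab
    · exact ⟨b, Finset.mem_inter.2 ⟨hb, hab.2⟩⟩
    · exact ⟨a, Finset.mem_inter.2 ⟨ha, hab.2⟩⟩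
  · rw [hB₂]; exact attach hJ₂ hv

/-- The probability that `B` is joined by the edges of `O` and the open edges of `R`. -/
noncomputable def joinProb (p : Sym2 Vt → ℝ) (O R : Finset (Sym2 Vt)) (B : Finset Vt) : ℝ :=
  expect p R fun ξ => ind (Joined (O ∪ ξ) B)

theorem joinProb_nonneg {p : Sym2 Vt → ℝ} (h0 : ∀ e, 0 ≤ p e) (h1 : ∀ e, p e ≤ 1)
    (O R : Finset (Sym2 Vt)) (B : Finset Vt) : 0 ≤ joinProb p O R B :=
  expect_nonneg h0 h1 fun _ _ => ind_nonneg _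

theorem joinProb_insert {p : Sym2 Vt → ℝ} {O R : Finset (Sym2 Vt)} {e : Sym2 Vt} (he : e ∉ R)
    (B : Finset Vt) :
    joinProb p O (insert e R) B =
      (1 - p e) * joinProb p O R B + p e * joinProb p (insert e O) R B := by
  unfold joinProb
  simp only [expect_insert he, Finset.union_insert, Finset.insert_union]

/-- The probability that two independent configurations on `R`, sharing the edges of `O`, satisfy
`SplitJoined A c` disjointly. -/
noncomputable def splitProb (p : Sym2 Vt → ℝ) (O R : Finset (Sym2 Vt)) (A : Finset Vt) (c : Vt) :
    ℝ :=
  expect₂ p R fun ξ η => ind (Shared (SplitJoined A c) O ξ η)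

theorem splitProb_nonneg {p : Sym2 Vt → ℝ} (h0 : ∀ e, 0 ≤ p e) (h1 : ∀ e, p e ≤ 1)
    (O R : Finset (Sym2 Vt)) (A : Finset Vt) (c : Vt) : 0 ≤ splitProb p O R A c :=
  expect₂_nonneg h0 h1 fun _ _ => ind_nonneg _

/-- The bound carried through the exploration. -/
noncomputable def explorationBound (p : Sym2 Vt → ℝ) (O R : Finset (Sym2 Vt)) (A : Finset Vt)
    (a : Vt) : ℝ :=
  ∑ c ∈ A.erase a, √(joinProb p O R (A.erase c) * splitProb p O R A c)

theorem explorationBound_nonneg (p : Sym2 Vt → ℝ) (O R : Finset (Sym2 Vt)) (A : Finset Vt)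
    (a : Vt) : 0 ≤ explorationBound p O R A a :=
  Finset.sum_nonneg fun _ _ => Real.sqrt_nonneg _

theorem explorationBound_insert {p : Sym2 Vt → ℝ} (h0 : ∀ e, 0 ≤ p e) (h1 : ∀ e, p e ≤ 1)
    {O R : Finset (Sym2 Vt)} {e : Sym2 Vt} (he : e ∉ R) (A : Finset Vt) (a : Vt) :
    (1 - p e) * explorationBound p O R A a + p e * explorationBound p (insert e O) R A a ≤
      explorationBound p O (insert e R) A a := by
  unfold explorationBound
  rw [Finset.mul_sum, Finset.mul_sum, ← Finset.sum_add_distrib]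
  refine Finset.sum_le_sum fun c _ => ?_
  refine (convex_comb_sqrt_mul_le (sub_nonneg.2 (h1 e)) (h0 e) (joinProb_nonneg h0 h1 _ _ _)
    (joinProb_nonneg h0 h1 _ _ _) (splitProb_nonneg h0 h1 _ _ _ _)
    (splitProb_nonneg h0 h1 _ _ _ _)).trans (Real.sqrt_le_sqrt ?_)
  rw [joinProb_insert he]
  refine mul_le_mul_of_nonneg_left
    (expect₂_shared_le h0 h1 SplitJoined.mono he O) ?_
  rw [← joinProb_insert he]
  exact joinProb_nonneg h0 h1 _ _ _

theorem Explored.joinProb_le_of_sdiff_eq_singleton {p : Sym2 Vt → ℝ} (h0 : ∀ e, 0 ≤ p e)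
    (h1 : ∀ e, p e ≤ 1) {a b c : Vt} {O R : Finset (Sym2 Vt)} {W A : Finset Vt} {S : List Vt}
    (h : Explored a O W (b :: S)) (hS : S ≠ []) (ha : a ∈ A) (hb : b ∈ A) (hc : A \ W = {c})
    (hR : ∀ x ∈ W, ∀ y ∉ W, s(x, y) ∈ R → x ∈ b :: S) :
    joinProb p O R A ≤ explorationBound p O R A a := by
  have hc' : c ∈ A \ W := by rw [hc]; simp
  obtain ⟨hcA, hcW⟩ := Finset.mem_sdiff.1 hc'
  have hca : c ≠ a := by
    rintro rfl
    exact hcW h.start_mem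
  have hsub : A.erase c ⊆ W := by
    intro x hx
    by_contra hxW
    have : x ∈ A \ W := Finset.mem_sdiff.2 ⟨Finset.mem_of_mem_erase hx, hxW⟩
    rw [hc] at this
    exact Finset.ne_of_mem_erase hx (Finset.mem_singleton.1 this)
  have hone : joinProb p O R (A.erase c) = 1 := by
    unfold joinProb
    rw [expect_congr (g := fun _ => 1) fun ξ _ =>
      ind_of (h.joined.mono Finset.subset_union_left hsub), expect_const]
  have hsq : joinProb p O R A ^ 2 ≤ splitProb p O R A c := by
    unfold joinProb splitProb
    rw [sq, ← expect₂_mul]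
    refine expect₂_mono h0 h1 fun ξ hξ η hη => ?_
    by_cases h₁ : Joined (O ∪ ξ) A
    · by_cases h₂ : Joined (O ∪ η) A
      · rw [ind_of h₁, ind_of h₂, ind_of (h.shared_splitJoined hS ha hb hc hξ hη hR h₁ h₂), one_mul]
      · rw [ind_of_not h₂, mul_zero]; exact ind_nonneg _
    · rw [ind_of_not h₁, zero_mul]; exact ind_nonneg _
  refine le_trans ?_ (Finset.single_le_sum (f := fun c => √(joinProb p O R (A.erase c) *
    splitProb p O R A c)) (fun _ _ => Real.sqrt_nonneg _) (Finset.mem_erase.2 ⟨hca, hcA⟩))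
  apply Real.le_sqrt_of_sq_le
  rwa [hone, one_mul]

theorem Explored.joinProb_eq_zero {p : Sym2 Vt → ℝ} {a d : Vt} {O R : Finset (Sym2 Vt)}
    {W A : Finset Vt} (h : Explored a O W []) (ha : a ∈ A) (hd : d ∈ A) (hdW : d ∉ W)
    (hR : ∀ x ∈ W, ∀ y ∉ W, s(x, y) ∈ R → x ∈ ([] : List Vt)) : joinProb p O R A = 0 := by
  unfold joinProb
  rw [expect_congr (g := fun _ => 0), expect_const]
  refine fun ξ hξ => ind_of_not fun hJ => ?_
  obtain ⟨u, hu, -⟩ := h.exists_linked_stack hξ hR hdW h.start_mem (hJ d hd a ha)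
  simp at hu

/-- Along a depth-first exploration that has not yet found two vertices of `A`, the conditional
probability that `A` is joined is controlled by the exploration bound. -/
theorem Explored.joinProb_le {p : Sym2 Vt → ℝ} (h0 : ∀ e, 0 ≤ p e) (h1 : ∀ e, p e ≤ 1)
    {A : Finset Vt} {a : Vt} (ha : a ∈ A) (n : ℕ) :
    ∀ (O R : Finset (Sym2 Vt)) (W : Finset Vt) (S : List Vt), 2 * R.card + S.length ≤ n →
      Explored a O W S → (∀ x ∈ W, ∀ y ∉ W, s(x, y) ∈ R → x ∈ S) → 2 ≤ (A \ W).card →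
      joinProb p O R A ≤ explorationBound p O R A a := by
  induction n with
  | zero =>
    intro O R W S hn h hR hA
    obtain rfl : S = [] := List.length_eq_zero_iff.1 (by omega)
    obtain ⟨d, hd⟩ := Finset.card_pos.1 (show 0 < (A \ W).card by omega)
    obtain ⟨hdA, hdW⟩ := Finset.mem_sdiff.1 hd
    rw [h.joinProb_eq_zero ha hdA hdW hR]
    exact explorationBound_nonneg _ _ _ _ _
  | succ n ih =>
    intro O R W S hn h hR hA
    rcases S with _ | ⟨v, S⟩
    · obtain ⟨d, hd⟩ := Finset.card_pos.1 (show 0 < (A \ W).card by omega)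
      obtain ⟨hdA, hdW⟩ := Finset.mem_sdiff.1 hd
      rw [h.joinProb_eq_zero ha hdA hdW hR]
      exact explorationBound_nonneg _ _ _ _ _
    · rw [List.length_cons] at hn
      by_cases hw : ∃ w, w ∉ W ∧ s(v, w) ∈ R
      · obtain ⟨w, hwW, hwR⟩ := hw
        obtain ⟨R', hR', rfl⟩ : ∃ R', s(v, w) ∉ R' ∧ R = insert s(v, w) R' :=
          ⟨R.erase s(v, w), Finset.notMem_erase _ _, (Finset.insert_erase hwR).symm⟩
        rw [Finset.card_insert_of_notMem hR'] at hn
        refine le_trans ?_ (explorationBound_insert h0 h1 hR' A a)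
        rw [joinProb_insert hR']
        have hpush := h.push w hwW
        have hRpush : ∀ x ∈ insert w W, ∀ y ∉ insert w W, s(x, y) ∈ R' → x ∈ w :: v :: S := by
          intro x hx y hy hxy
          rcases Finset.mem_insert.1 hx with rfl | hx
          · exact List.mem_cons_self
          · exact List.mem_cons_of_mem _ (hR x hx y (fun hy' => hy (Finset.mem_insert_of_mem hy'))
              (Finset.mem_insert_of_mem hxy))
        refine add_le_add (mul_le_mul_of_nonneg_left ?_ (sub_nonneg.2 (h1 _)))
          (mul_le_mul_of_nonneg_left ?_ (h0 _))
        · refine ih O R' W (v :: S) (by rw [List.length_cons]; omega) h ?_ hA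
          exact fun x hx y hy hxy => hR x hx y hy (Finset.mem_insert_of_mem hxy)
        · by_cases hA' : 2 ≤ (A \ insert w W).card
          · exact ih _ R' _ _ (by simp only [List.length_cons]; omega) hpush hRpush hA'
          · have herase : A \ insert w W = (A \ W).erase w := by
              ext x; simp only [Finset.mem_sdiff, Finset.mem_insert, Finset.mem_erase]; tauto
            have hwA : w ∈ A \ W := by
              by_contra hwA
              rw [herase, Finset.erase_eq_of_notMem hwA] at hA'
              exact hA' hA
            have hcard : (A \ insert w W).card = 1 := by
              rw [herase, Finset.card_erase_of_mem hwA] at hA' ⊢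
              omega
            obtain ⟨c, hc⟩ := Finset.card_eq_one.1 hcard
            exact hpush.joinProb_le_of_sdiff_eq_singleton h0 h1 (List.cons_ne_nil _ _) ha
              (Finset.mem_sdiff.1 hwA).1 hc hRpush
      · refine ih O R W S (by omega) h.pop ?_ hA
        intro x hx y hy hxy
        rcases List.mem_cons.1 (hR x hx y hy hxy) with rfl | hh
        · exact absurd ⟨y, hy, hxy⟩ hw
        · exact hh

theorem splitProb_empty_le {p : Sym2 Vt → ℝ} (h0 : ∀ e, 0 ≤ p e) (h1 : ∀ e, p e ≤ 1)
    (R : Finset (Sym2 Vt)) (A : Finset Vt) (c : Vt) :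
    splitProb p ∅ R A c ≤
      ∑ B ∈ (A.erase c).powerset with B.Nonempty ∧ (A.erase c \ B).Nonempty,
        joinProb p ∅ R (insert c B) * joinProb p ∅ R (insert c (A.erase c \ B)) := by
  unfold splitProb joinProb
  simp only [← expect₂_mul]
  simp only [expect₂, ← expect_sum]
  refine expect₂_mono h0 h1 fun ξ _ η _ => ?_
  by_cases h : Shared (SplitJoined A c) ∅ ξ η
  · obtain ⟨O₁, O₂, hO₁, hO₂, -, B, hB, hB₁, hB₂, hJ₁, hJ₂⟩ := h
    rw [Finset.subset_empty.1 hO₁] at hJ₁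
    rw [Finset.subset_empty.1 hO₂] at hJ₂
    refine le_trans ?_ (Finset.single_le_sum (fun B _ => mul_nonneg (ind_nonneg _) (ind_nonneg _))
      (Finset.mem_filter.2 ⟨Finset.mem_powerset.2 hB, hB₁, hB₂⟩))
    rw [ind_of hJ₁, ind_of hJ₂, one_mul]
    exact ind_mono (fun _ => trivial) |>.trans_eq (ind_of trivial)
  · rw [ind_of_not h]
    exact Finset.sum_nonneg fun B _ => mul_nonneg (ind_nonneg _) (ind_nonneg _)

theorem exists_division {A : Finset Vt} (hA : 3 ≤ A.card) :
    ∃ c ∈ A, ∃ B ⊆ A.erase c, B.Nonempty ∧ (A.erase c \ B).Nonempty := by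
  obtain ⟨c, hc⟩ := Finset.card_pos.1 (show 0 < A.card by omega)
  obtain ⟨b, hb⟩ := Finset.card_pos.1 (show 0 < (A.erase c).card by
    rw [Finset.card_erase_of_mem hc]; omega)
  refine ⟨c, hc, {b}, by simpa using hb, Finset.singleton_nonempty b, ?_⟩
  rw [Finset.sdiff_singleton_eq_erase, ← Finset.card_pos, Finset.card_erase_of_mem hb,
    Finset.card_erase_of_mem hc]
  omega

theorem joinProb_sq_le {p : Sym2 Vt → ℝ} (h0 : ∀ e, 0 ≤ p e) (h1 : ∀ e, p e ≤ 1)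
    (R : Finset (Sym2 Vt)) {A : Finset Vt} (hA : 3 ≤ A.card) {K : ℝ}
    (hK : ∀ c ∈ A, ∀ B ⊆ A.erase c, B.Nonempty → (A.erase c \ B).Nonempty →
      joinProb p ∅ R (A.erase c) *
        (joinProb p ∅ R (insert c B) * joinProb p ∅ R (insert c (A.erase c \ B))) ≤ K) :
    joinProb p ∅ R A ^ 2 ≤ ((A.card - 1 : ℕ) : ℝ) ^ 2 * (2 ^ (A.card - 1) * K) := by
  obtain ⟨a, ha⟩ := Finset.card_pos.1 (show 0 < A.card by omega)
  have hK0 : 0 ≤ K := by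
    obtain ⟨c, hc, B, hB, hB₁, hB₂⟩ := exists_division hA
    exact (mul_nonneg (joinProb_nonneg h0 h1 _ _ _) (mul_nonneg (joinProb_nonneg h0 h1 _ _ _)
      (joinProb_nonneg h0 h1 _ _ _))).trans (hK c hc B hB hB₁ hB₂)
  have hW : 2 ≤ (A \ {a}).card := by
    rw [Finset.sdiff_singleton_eq_erase, Finset.card_erase_of_mem ha]; omega
  have hmain := Explored.joinProb_le h0 h1 ha _ ∅ R {a} [a] le_rfl Explored.start
    (fun x hx _ _ _ => by simpa using hx) hW
  have hterm : ∀ c ∈ A.erase a,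
      √(joinProb p ∅ R (A.erase c) * splitProb p ∅ R A c) ≤ √(2 ^ (A.card - 1) * K) := by
    intro c hc
    have hcA := Finset.mem_of_mem_erase hc
    refine Real.sqrt_le_sqrt ?_
    refine (mul_le_mul_of_nonneg_left (splitProb_empty_le h0 h1 R A c)
      (joinProb_nonneg h0 h1 _ _ _)).trans ?_
    rw [Finset.mul_sum]
    refine (Finset.sum_le_card_nsmul _ _ K fun B hB => ?_).trans ?_
    · obtain ⟨hB, hB₁, hB₂⟩ := Finset.mem_filter.1 hB
      exact hK c hcA B (Finset.mem_powerset.1 hB) hB₁ hB₂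
    · rw [nsmul_eq_mul]
      refine mul_le_mul_of_nonneg_right ?_ hK0
      have := Finset.card_filter_le (A.erase c).powerset
        fun B => B.Nonempty ∧ (A.erase c \ B).Nonempty
      rw [Finset.card_powerset, Finset.card_erase_of_mem hcA] at this
      exact_mod_cast this
  have hle : joinProb p ∅ R A ≤ ((A.card - 1 : ℕ) : ℝ) * √(2 ^ (A.card - 1) * K) := by
    refine hmain.trans ((Finset.sum_le_card_nsmul _ _ _ hterm).trans_eq ?_)
    rw [nsmul_eq_mul, Finset.card_erase_of_mem ha]
  refine (pow_le_pow_left₀ (joinProb_nonneg h0 h1 _ _ _) hle 2).trans_eq ?_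
  rw [mul_pow, Real.sq_sqrt (by positivity)]

end Exploration

/-! ## Bernoulli percolation -/

section Percolation

variable {Vt : Type*}

/-- The event that the vertices of `B` are joined by open edges of `E`. -/
def joinEvent (E : Finset (Sym2 Vt)) (B : Finset Vt) : Set (Sym2 Vt → Bool) :=
  {ω | Joined (E.filter fun e => ω e = true) B}

/-- The event that the vertices of `B` lie in a single cluster. -/
def connEvent (B : Finset Vt) : Set (Sym2 Vt → Bool) := {ω | ∀ x ∈ B, ∀ y ∈ B, Conn ω x y}

theorem joinEvent_mono {E F : Finset (Sym2 Vt)} (h : E ⊆ F) (B : Finset Vt) :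
    joinEvent E B ⊆ joinEvent F B :=
  fun _ hω => Joined.mono (Finset.filter_subset_filter _ h) subset_rfl hω

theorem joinEvent_subset_connEvent (E : Finset (Sym2 Vt)) (B : Finset Vt) :
    joinEvent E B ⊆ connEvent B :=
  fun ω hω x hx y hy =>
    Relation.ReflTransGen.mono (r := fun a b => s(a, b) ∈ E.filter fun e => ω e = true)
      (p := fun a b => ω s(a, b) = true) (fun _ _ h => (Finset.mem_filter.1 h).2) x y (hω x hx y hy)

theorem Conn.exists_linked {ω : Sym2 Vt → Bool} {x y : Vt} (h : Conn ω x y) :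
    ∃ E : Finset (Sym2 Vt), Linked (E.filter fun e => ω e = true) x y := by
  induction h with
  | refl => exact ⟨∅, Relation.ReflTransGen.refl⟩
  | @tail y z _ hyz ih =>
    obtain ⟨E, hE⟩ := ih
    refine ⟨insert s(y, z) E, (hE.mono ?_).trans (Linked.of_mem ?_)⟩
    · exact Finset.filter_subset_filter _ (Finset.subset_insert _ _)
    · exact Finset.mem_filter.2 ⟨Finset.mem_insert_self _ _, hyz⟩

theorem iUnion_joinEvent (B : Finset Vt) : ⋃ E, joinEvent E B = connEvent B := by
  refine Set.Subset.antisymm (Set.iUnion_subset fun E => joinEvent_subset_connEvent E B) ?_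
  intro ω hω
  have hex : ∀ q : Vt × Vt, ∃ E : Finset (Sym2 Vt), q ∈ B ×ˢ B →
      Linked (E.filter fun e => ω e = true) q.1 q.2 := by
    intro q
    by_cases hq : q ∈ B ×ˢ B
    · obtain ⟨h1, h2⟩ := Finset.mem_product.1 hq
      obtain ⟨E, hE⟩ := Conn.exists_linked (hω q.1 h1 q.2 h2)
      exact ⟨E, fun _ => hE⟩
    · exact ⟨∅, fun h => absurd h hq⟩
  choose E hE using hex
  refine Set.mem_iUnion.2 ⟨(B ×ˢ B).biUnion E, fun x hx y hy => ?_⟩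
  have hxy := Finset.mk_mem_product hx hy
  exact (hE (x, y) hxy).mono
    (Finset.filter_subset_filter _ (Finset.subset_biUnion_of_mem E hxy))

theorem IsPerc.measure_joinEvent {μ : Measure (Sym2 Vt → Bool)} {p : Sym2 Vt → ℝ}
    (hμ : IsPerc μ p) (h0 : ∀ e, 0 ≤ p e) (h1 : ∀ e, p e ≤ 1) (E : Finset (Sym2 Vt))
    (B : Finset Vt) : μ (joinEvent E B) = ENNReal.ofReal (joinProb p ∅ E B) := by
  let cyl : Finset (Sym2 Vt) → Set (Sym2 Vt → Bool) := fun ξ => {ω | ∀ e ∈ E, ω e = decide (e ∈ ξ)}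
  have hcyl : ∀ ξ ⊆ E, ∀ ω, ω ∈ cyl ξ ↔ E.filter (fun e => ω e = true) = ξ := by
    intro ξ hξ ω
    constructor
    · intro h
      ext e
      rw [Finset.mem_filter]
      constructor
      · rintro ⟨he, hω⟩
        rw [h e he] at hω
        exact of_decide_eq_true hω
      · intro he
        exact ⟨hξ he, by rw [h e (hξ he)]; exact decide_eq_true he⟩
    · rintro rfl e he
      by_cases hω : ω e = true <;> simp [he, hω]
  have hunion : joinEvent E B = ⋃ ξ ∈ E.powerset.filter fun ξ => Joined (∅ ∪ ξ) B, cyl ξ := by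
    ext ω
    simp only [Set.mem_iUnion, Finset.mem_filter, Finset.mem_powerset, exists_prop,
      Finset.empty_union]
    constructor
    · intro hω
      exact ⟨_, ⟨Finset.filter_subset _ _, hω⟩, (hcyl _ (Finset.filter_subset _ _) ω).2 rfl⟩
    · rintro ⟨ξ, ⟨hξ, hJ⟩, hω⟩
      rw [← (hcyl ξ hξ ω).1 hω] at hJ
      exact hJ
  have hdisj : (↑(E.powerset.filter fun ξ => Joined (∅ ∪ ξ) B) :
      Set (Finset (Sym2 Vt))).PairwiseDisjoint cyl := by
    intro ξ hξ η hη hne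
    rw [Function.onFun, Set.disjoint_left]
    intro ω h1 h2
    have hξ' := Finset.mem_powerset.1 (Finset.mem_filter.1 (Finset.mem_coe.1 hξ)).1
    have hη' := Finset.mem_powerset.1 (Finset.mem_filter.1 (Finset.mem_coe.1 hη)).1
    exact hne (((hcyl ξ hξ' ω).1 h1).symm.trans ((hcyl η hη' ω).1 h2))
  have hmeas : ∀ ξ, MeasurableSet (cyl ξ) := by
    intro ξ
    have : cyl ξ = ⋂ e ∈ E, (fun ω : Sym2 Vt → Bool => ω e) ⁻¹' {decide (e ∈ ξ)} := by
      ext ω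
      simp [cyl]
    rw [this]
    exact Finset.measurableSet_biInter E fun e _ => measurable_pi_apply e (measurableSet_singleton _)
  rw [hunion, measure_biUnion_finset hdisj fun ξ _ => hmeas ξ]
  have hterm : ∀ ξ, μ (cyl ξ) = ENNReal.ofReal (wt p E ξ) := by
    intro ξ
    rw [hμ.2 E fun e => decide (e ∈ ξ), wt, ENNReal.ofReal_prod_of_nonneg]
    · simp only [decide_eq_true_eq]
    · intro e _
      split_ifs
      · exact h0 e
      · linarith [h1 e]
  simp only [hterm]
  rw [← ENNReal.ofReal_sum_of_nonneg fun ξ _ => wt_nonneg h0 h1 E ξ, Finset.sum_filter]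
  simp only [joinProb, expect, ind, mul_ite, mul_one, mul_zero]

theorem measure_connEvent_eq_iSup [Countable Vt] (μ : Measure (Sym2 Vt → Bool)) (B : Finset Vt) :
    μ (connEvent B) = ⨆ E, μ (joinEvent E B) := by
  have : Countable (Sym2 Vt) := Quot.mk_surjective.countable
  rw [← iUnion_joinEvent]
  refine Directed.measure_iUnion fun E F => ⟨E ∪ F, ?_, ?_⟩
  · exact joinEvent_mono Finset.subset_union_left B
  · exact joinEvent_mono Finset.subset_union_right B

/-- A measurable set in a product space depends on countably many coordinates only. -/
theorem exists_countable_determining {ι : Type*} {X : ι → Type*} [∀ i, MeasurableSpace (X i)]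
    {t : Set (∀ i, X i)} (ht : MeasurableSet t) :
    ∃ S : Set ι, S.Countable ∧ ∀ ω ω' : ∀ i, X i, (∀ i ∈ S, ω i = ω' i) → ω ∈ t → ω' ∈ t := by
  let m : MeasurableSpace (∀ i, X i) :=
    { MeasurableSet' := fun t => ∃ S : Set ι, S.Countable ∧
        ∀ ω ω' : ∀ i, X i, (∀ i ∈ S, ω i = ω' i) → ω ∈ t → ω' ∈ t
      measurableSet_empty := ⟨∅, Set.countable_empty, fun _ _ _ h => h⟩
      measurableSet_compl := by
        rintro t ⟨S, hS, h⟩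
        exact ⟨S, hS, fun ω ω' hω hn hω' => hn (h ω' ω (fun i hi => (hω i hi).symm) hω')⟩
      measurableSet_iUnion := by
        intro f hf
        choose S hS h using hf
        refine ⟨⋃ n, S n, Set.countable_iUnion hS, fun ω ω' hω hmem => ?_⟩
        obtain ⟨n, hn⟩ := Set.mem_iUnion.1 hmem
        exact Set.mem_iUnion.2
          ⟨n, h n ω ω' (fun i hi => hω i (Set.mem_iUnion.2 ⟨n, hi⟩)) hn⟩ }
  have hle : MeasurableSpace.pi ≤ m := by
    refine iSup_le fun i => ?_
    rintro _ ⟨s, _, rfl⟩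
    refine ⟨{i}, Set.countable_singleton i, fun ω ω' hω hmem => ?_⟩
    rw [Set.mem_preimage] at hmem ⊢
    rwa [← hω i rfl]
  exact hle t ht

/-- On an uncountable vertex set, every measurable set containing a connection event is the whole
space, so the connection event has full outer measure. -/
theorem measure_connEvent_eq_one [Uncountable Vt] (μ : Measure (Sym2 Vt → Bool))
    [IsProbabilityMeasure μ] (B : Finset Vt) : μ (connEvent B) = 1 := by
  obtain ⟨t, hsub, ht, hμt⟩ := exists_measurable_superset μ (connEvent B)
  obtain ⟨S, hS, hdet⟩ := exists_countable_determining ht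
  have hbad : (⋃ x ∈ B, (fun z => s(z, x)) ⁻¹' S).Countable := by
    refine Set.Countable.biUnion B.countable_toSet fun x _ => hS.preimage_of_injOn ?_
    exact fun z _ z' _ h => Sym2.congr_left.1 h
  obtain ⟨z, hz⟩ : ∃ z, z ∉ ⋃ x ∈ B, (fun z => s(z, x)) ⁻¹' S := by
    by_contra! h
    exact Set.not_countable_univ (hbad.mono fun z _ => h z)
  have hz' : ∀ x ∈ B, s(z, x) ∉ S := fun x hx h => hz (Set.mem_biUnion hx h)
  have huniv : t = Set.univ := by
    refine Set.eq_univ_of_forall fun ω => ?_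
    let ω' : Sym2 Vt → Bool := fun e => if ∃ x ∈ B, e = s(z, x) then true else ω e
    refine hdet ω' ω ?_ (hsub ?_)
    · intro e he
      refine if_neg ?_
      rintro ⟨x, hx, rfl⟩
      exact hz' x hx he
    · intro x hx y hy
      have hopen : ∀ x ∈ B, ω' s(z, x) = true := fun x hx => if_pos ⟨x, hx, rfl⟩
      refine (Relation.ReflTransGen.single ?_).tail (hopen y hy)
      rw [Sym2.eq_swap]
      exact hopen x hx
  rw [← hμt, huniv, measure_univ]

theorem edgeProb_nonneg {t : ℝ} (ht : 0 ≤ t) : 0 ≤ edgeProb t := by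
  have := Real.exp_le_one_iff.2 (neg_nonpos.2 ht)
  unfold edgeProb
  linarith

theorem edgeProb_le_one (t : ℝ) : edgeProb t ≤ 1 := by
  have := Real.exp_pos (-t)
  unfold edgeProb
  linarith

theorem two_pow_pred_le {n : ℕ} (hn : 3 ≤ n) : 2 ^ (n - 1) ≤ 4 * (2 ^ (n - 2) - 1) := by
  obtain ⟨m, rfl⟩ := Nat.exists_eq_add_of_le' hn
  have h1 : 1 ≤ 2 ^ m := Nat.one_le_two_pow
  have h2 : m + 3 - 1 = m + 2 := rfl
  have h3 : m + 3 - 2 = m + 1 := rfl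
  rw [h2, h3, pow_succ, pow_succ]
  omega

/-- If `K` bounds all the products of three connection probabilities, then it bounds the square of
the connection probability of `A`, up to a constant. -/
theorem IsPerc.measure_connEvent_sq_le [Countable Vt] {μ : Measure (Sym2 Vt → Bool)}
    {p : Sym2 Vt → ℝ} (hμ : IsPerc μ p) (h0 : ∀ e, 0 ≤ p e) (h1 : ∀ e, p e ≤ 1) {A : Finset Vt}
    (hA : 3 ≤ A.card) {K : ℝ}
    (hK : ∀ c ∈ A, ∀ B ⊆ A.erase c, B.Nonempty → (A.erase c \ B).Nonempty →
      μ.real (connEvent (A.erase c)) *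
        (μ.real (connEvent (insert c B)) * μ.real (connEvent (insert c (A.erase c \ B)))) ≤ K) :
    μ.real (connEvent A) ^ 2 ≤ ((A.card - 1 : ℕ) : ℝ) ^ 2 * (2 ^ (A.card - 1) * K) := by
  have := hμ.1
  have hle : ∀ E B, joinProb p ∅ E B ≤ μ.real (connEvent B) := by
    intro E B
    rw [measureReal_def, ← ENNReal.ofReal_le_iff_le_toReal (measure_ne_top _ _),
      ← hμ.measure_joinEvent h0 h1]
    exact measure_mono (joinEvent_subset_connEvent E B)
  have hn := joinProb_nonneg h0 h1
  have hE : ∀ E, joinProb p ∅ E A ^ 2 ≤ ((A.card - 1 : ℕ) : ℝ) ^ 2 * (2 ^ (A.card - 1) * K) := by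
    refine fun E => joinProb_sq_le h0 h1 E hA fun c hc B hB hB₁ hB₂ =>
      le_trans ?_ (hK c hc B hB hB₁ hB₂)
    exact mul_le_mul (hle _ _) (mul_le_mul (hle _ _) (hle _ _) (hn _ _ _) measureReal_nonneg)
      (mul_nonneg (hn _ _ _) (hn _ _ _)) measureReal_nonneg
  have hC := (sq_nonneg _).trans (hE ∅)
  rw [← Real.le_sqrt measureReal_nonneg hC, measureReal_def]
  refine ENNReal.toReal_le_of_le_ofReal (Real.sqrt_nonneg _) ?_
  rw [measure_connEvent_eq_iSup]
  refine iSup_le fun E => ?_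
  rw [hμ.measure_joinEvent h0 h1]
  exact ENNReal.ofReal_le_ofReal (Real.le_sqrt_of_sq_le (hE E))

end Percolation

/-- **higher-order Gladkov inequality.** Let `G = (V, E, J)` be a weighted
graph and `β ≥ 0`, and for a finite vertex set `A` let `τ(A)` be the probability that all
the vertices of `A` lie in the same cluster of Bernoulli bond percolation on `G`.  Then for
every finite `A` with `|A| ≥ 3`,
`τ(A)² ≤ 4(|A|-1)²(2^{|A|-2}-1) max τ(A₁∪A₂) τ(A₂∪A₃) τ(A₃∪A₁)`,
the maximum being over partitions of `A` into three nonempty subsets `A₁`, `A₂`, `A₃`. -/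
theorem statement11 (Vt : Type*) (J : Vt → Vt → ℝ)
    (hJsym : ∀ x y, J x y = J y x) (hJnn : ∀ x y, 0 ≤ J x y)
    (β : ℝ) (hβ : 0 ≤ β) (μ : Measure (Sym2 Vt → Bool))
    (hμ : IsPerc μ (Sym2.lift ⟨fun x y => edgeProb (β * J x y), fun x y => by
      show edgeProb (β * J x y) = edgeProb (β * J y x); rw [hJsym x y]⟩))
    (A : Finset Vt) (hA : 3 ≤ A.card) :
    ∃ A₁ A₂ A₃ : Finset Vt,
      A₁.Nonempty ∧ A₂.Nonempty ∧ A₃.Nonempty ∧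
      Disjoint A₁ A₂ ∧ Disjoint A₁ A₃ ∧ Disjoint A₂ A₃ ∧ A₁ ∪ A₂ ∪ A₃ = A ∧
      (μ {ω | ∀ x ∈ A, ∀ y ∈ A, Conn ω x y}) ^ 2 ≤
        ((4 * (A.card - 1) ^ 2 * (2 ^ (A.card - 2) - 1) : ℕ) : ℝ≥0∞) *
          (μ {ω | ∀ x ∈ A₁ ∪ A₂, ∀ y ∈ A₁ ∪ A₂, Conn ω x y} *
            μ {ω | ∀ x ∈ A₂ ∪ A₃, ∀ y ∈ A₂ ∪ A₃, Conn ω x y} *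
            μ {ω | ∀ x ∈ A₃ ∪ A₁, ∀ y ∈ A₃ ∪ A₁, Conn ω x y}) := by
  have hprob := hμ.1
  set C : ℕ := 4 * (A.card - 1) ^ 2 * (2 ^ (A.card - 2) - 1) with hC
  have hCle : (A.card - 1) ^ 2 * 2 ^ (A.card - 1) ≤ C := by
    have := Nat.mul_le_mul_left ((A.card - 1) ^ 2) (two_pow_pred_le hA)
    rw [hC]
    calc _ ≤ _ := this
      _ = _ := by ring
  suffices h : ∃ c ∈ A, ∃ B ⊆ A.erase c, B.Nonempty ∧ (A.erase c \ B).Nonempty ∧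
      μ.real (connEvent A) ^ 2 ≤ C * (μ.real (connEvent (A.erase c)) *
        (μ.real (connEvent (insert c B)) * μ.real (connEvent (insert c (A.erase c \ B))))) by
    obtain ⟨c, hc, B, hB, hB₁, hB₂, h⟩ := h
    have hcB : c ∉ B := fun hh => Finset.notMem_erase c A (hB hh)
    refine ⟨{c}, B, A.erase c \ B, Finset.singleton_nonempty c, hB₁, hB₂, by simpa using hcB,
      by simp, Finset.disjoint_sdiff, ?_, ?_⟩
    · rw [Finset.union_assoc, Finset.union_sdiff_of_subset hB, ← Finset.insert_eq,
        Finset.insert_erase hc]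
    · have e1 : {c} ∪ B = insert c B := rfl
      have e2 : A.erase c \ B ∪ {c} = insert c (A.erase c \ B) := by
        rw [Finset.union_comm]; rfl
      rw [Finset.union_sdiff_of_subset hB, e1, e2]
      change μ (connEvent A) ^ 2 ≤ C * (μ (connEvent (insert c B)) * μ (connEvent (A.erase c)) *
        μ (connEvent (insert c (A.erase c \ B))))
      rw [← ENNReal.toReal_le_toReal (by finiteness) (by finiteness)]
      simp only [ENNReal.toReal_pow, ENNReal.toReal_mul, ENNReal.toReal_natCast,
        ← measureReal_def]
      refine h.trans_eq ?_
      ring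
  rcases (em (Countable Vt)).imp_right not_countable_iff.1 with hV | hV
  · have h0 : ∀ e, 0 ≤ Sym2.lift ⟨fun x y => edgeProb (β * J x y), fun x y => by
        show edgeProb (β * J x y) = edgeProb (β * J y x); rw [hJsym x y]⟩ e := by
      refine Sym2.ind fun x y => ?_
      exact edgeProb_nonneg (mul_nonneg hβ (hJnn x y))
    have h1 : ∀ e, Sym2.lift ⟨fun x y => edgeProb (β * J x y), fun x y => by
        show edgeProb (β * J x y) = edgeProb (β * J y x); rw [hJsym x y]⟩ e ≤ 1 := by
      refine Sym2.ind fun x y => ?_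
      exact edgeProb_le_one _
    let T : Finset (Vt × Finset Vt) := (A ×ˢ A.powerset).filter fun q =>
      q.2 ⊆ A.erase q.1 ∧ q.2.Nonempty ∧ (A.erase q.1 \ q.2).Nonempty
    have hT : ∀ c ∈ A, ∀ B ⊆ A.erase c, B.Nonempty → (A.erase c \ B).Nonempty → (c, B) ∈ T :=
      fun c hc B hB hB₁ hB₂ => Finset.mem_filter.2 ⟨Finset.mk_mem_product hc
        (Finset.mem_powerset.2 (hB.trans (Finset.erase_subset _ _))), hB, hB₁, hB₂⟩
    obtain ⟨c₀, hc₀, B₀, hB₀, hB₀₁, hB₀₂⟩ := exists_division hA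
    obtain ⟨⟨c, B⟩, hcB, hmax⟩ := T.exists_max_image (fun q => μ.real (connEvent (A.erase q.1)) *
      (μ.real (connEvent (insert q.1 q.2)) * μ.real (connEvent (insert q.1 (A.erase q.1 \ q.2)))))
      ⟨_, hT c₀ hc₀ B₀ hB₀ hB₀₁ hB₀₂⟩
    obtain ⟨hc, hB, hB₁, hB₂⟩ := Finset.mem_filter.1 hcB
    refine ⟨c, (Finset.mem_product.1 hc).1, B, hB, hB₁, hB₂, ?_⟩
    have key := hμ.measure_connEvent_sq_le h0 h1 hA fun c' hc' B' hB' hB₁' hB₂' =>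
      hmax (c', B') (hT c' hc' B' hB' hB₁' hB₂')
    refine key.trans ?_
    rw [← mul_assoc]
    refine mul_le_mul_of_nonneg_right ?_ (by positivity)
    clear_value C
    exact_mod_cast hCle
  · obtain ⟨c, hc, B, hB, hB₁, hB₂⟩ := exists_division hA
    refine ⟨c, hc, B, hB, hB₁, hB₂, ?_⟩
    simp only [measureReal_def, measure_connEvent_eq_one, ENNReal.toReal_one, one_pow, mul_one]
    have : 1 ≤ C := le_trans (Nat.one_le_iff_ne_zero.2 (mul_ne_zero
      (pow_ne_zero _ (by omega)) (pow_ne_zero _ two_ne_zero))) hCle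
    exact_mod_cast this

end LRP
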